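/- A polygonal chain with m segments in ℝ^k covers at most 2m + 1 points of the grid {0,1,2}^k, where each segment covers at most 3 grid points and consecutive segments share an endpoint; consequently any covering trail of {0,1,2}^k requires at least (3^k - 1)/2 segments. -/

import Mathlib

/-- The embedding of `𝔽₃^k` onto the grid `{0,1,2}^k`. -/
noncomputable def gridPt {k : ℕ} (a : Fin k → ZMod 3) : Fin k → ℝ := fun i => ((a i).val : ℝ)

/-- `t` is a rational number whose denominator is congruent to `1` modulo `3`. -/
def IsInt3 (t : ℝ) : Prop := ∃ n d : ℤ, (d : ZMod 3) = 1 ∧ (d : ℝ) * t = n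

lemma sq_one_of_ne {a b : ZMod 3} (h : a ≠ b) : (a - b) * (a - b) = 1 := by
  revert a b; decide

lemma val_cast_int (a : ZMod 3) : (((a.val : ℕ) : ℤ) : ZMod 3) = a := by
  revert a; decide

lemma coord_cases (a b c d : ZMod 3) (hab : a ≠ b) (hcd : c ≠ d) (t s : ℝ) (ht : 0 < t)
    (hs : 0 < s)
    (h : (a.val : ℝ) + t * (a.val - b.val) = c.val + s * (c.val - d.val)) :
    ((s = t ∨ t = 2 * s ∨ s = 2 * t) ∧ a = c + 0 * (c - d)) ∨
    (t = 1 + s ∧ a = c + 2 * (c - d)) ∨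
    ((t = 1 + 2 * s ∨ s = 1 + t ∨ s = 1 + 2 * t) ∧ a = c + 1 * (c - d)) := by
  have h0 : ((0 : ZMod 3).val : ℝ) = 0 := by norm_num
  have h1 : ((1 : ZMod 3).val : ℝ) = 1 := by
    rw [show (1 : ZMod 3).val = 1 from rfl]; norm_num
  have h2 : ((2 : ZMod 3).val : ℝ) = 2 := by
    rw [show (2 : ZMod 3).val = 2 from rfl]; norm_num
  have e : ∀ x : ZMod 3, x = 0 ∨ x = 1 ∨ x = 2 := by decide
  rcases e a with rfl | rfl | rfl <;> rcases e b with rfl | rfl | rfl <;>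
    first
    | exact absurd rfl hab
    | (rcases e c with rfl | rfl | rfl <;> rcases e d with rfl | rfl | rfl <;>
        first
        | exact absurd rfl hcd
        | (simp only [h0, h1, h2] at h
           first
           | (exfalso; linarith)
           | exact Or.inl ⟨Or.inl (by linarith), by decide⟩
           | exact Or.inl ⟨Or.inr (Or.inl (by linarith)), by decide⟩
           | exact Or.inl ⟨Or.inr (Or.inr (by linarith)), by decide⟩
           | exact Or.inr (Or.inl ⟨by linarith, by decide⟩)
           | exact Or.inr (Or.inr ⟨Or.inl (by linarith), by decide⟩)
           | exact Or.inr (Or.inr ⟨Or.inr (Or.inl (by linarith)), by decide⟩)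
           | exact Or.inr (Or.inr ⟨Or.inr (Or.inr (by linarith)), by decide⟩)))

/-- If `P i` is 3-integral at a coordinate where `a`, `b` differ then `t` is 3-integral. -/
lemma isInt3_of_coord (a b : ZMod 3) (hab : a ≠ b) (t x : ℝ) (hx : IsInt3 x)
    (h : x = a.val + t * (a.val - b.val)) : IsInt3 t := by
  obtain ⟨n, d, hd, hn⟩ := hx
  refine ⟨((a.val : ℤ) - b.val) * (n - d * a.val), d * (((a.val : ℤ) - b.val) * ((a.val : ℤ) - b.val)), ?_, ?_⟩
  · push_cast [val_cast_int]
    have := sq_one_of_ne hab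
    simp only [ZMod.natCast_val, ZMod.cast_id', id_eq]
    rw [hd, this]; rfl
  · push_cast
    rw [← hn, h]; ring

lemma isInt3_nat (n : ℕ) : IsInt3 n := ⟨n, 1, by simp, by simp⟩

/-- Reduction modulo 3 of a 3-integral point lies on the reduction of every grid line through it. -/
lemma red_int {k : ℕ} (P : Fin k → ℝ) (d : ℤ) (hd : (d : ZMod 3) = 1) (N : Fin k → ℤ)
    (hN : ∀ i, (d : ℝ) * P i = N i) (a b : Fin k → ZMod 3) (hab : a ≠ b) (t : ℝ)
    (h : ∀ i, P i = gridPt a i + t * (gridPt a i - gridPt b i)) :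
    ∃ μ : ZMod 3, ∀ i, (N i : ZMod 3) = a i + μ * (a i - b i) := by
  obtain ⟨j, hj⟩ := Function.ne_iff.mp hab
  have hsq := sq_one_of_ne hj
  set e : ℤ := ((a j).val : ℤ) - (b j).val with he
  have hez : (e : ZMod 3) = a j - b j := by
    rw [he]; push_cast; simp
  set n' : ℤ := e * (N j - d * (a j).val) with hn'
  refine ⟨(n' : ZMod 3), fun i => ?_⟩
  have key : e * e * N i = d * (e * e) * (a i).val + n' * (((a i).val : ℤ) - (b i).val) := by
    have : ((e * e * N i : ℤ) : ℝ) =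
        ((d * (e * e) * (a i).val + n' * (((a i).val : ℤ) - (b i).val) : ℤ) : ℝ) := by
      rw [hn']
      push_cast
      rw [← hN i, ← hN j, h i, h j, he]
      simp only [gridPt]
      push_cast
      ring
    exact_mod_cast this
  have k2 := congrArg (fun z : ℤ => (z : ZMod 3)) key
  simp only [Int.cast_mul, Int.cast_add, Int.cast_sub, val_cast_int, hd] at k2
  rw [hez, hsq] at k2
  simpa using k2

/-- Reduction modulo 3 of a point, compatible with all grid lines seen from outside. -/
lemma exists_red {k : ℕ} (P : Fin k → ℝ) : ∃ r : Fin k → ZMod 3,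
    ∀ a b : Fin k → ZMod 3, a ≠ b → ∀ t : ℝ, 0 ≤ t →
      (∀ i, P i = gridPt a i + t * (gridPt a i - gridPt b i)) →
      ∃ μ : ZMod 3, ∀ i, r i = a i + μ * (a i - b i) := by
  by_cases hint : ∃ d : ℤ, (d : ZMod 3) = 1 ∧ ∀ i, ∃ n : ℤ, (d : ℝ) * P i = n
  · obtain ⟨d, hd, hN⟩ := hint
    choose N hN using hN
    refine ⟨fun i => (N i : ZMod 3), ?_⟩
    exact fun a b hab t _ h => red_int P d hd N hN a b hab t h
  · by_cases hex : ∃ a b : Fin k → ZMod 3, a ≠ b ∧ ∃ t : ℝ, 0 ≤ t ∧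
      (∀ i, P i = gridPt a i + t * (gridPt a i - gridPt b i))
    swap
    · refine ⟨0, fun a b hab t ht h => absurd ⟨a, b, hab, t, ht, h⟩ hex⟩
    have nonint : ∀ a b : Fin k → ZMod 3, ∀ t : ℝ,
        (∀ i, P i = gridPt a i + t * (gridPt a i - gridPt b i)) → ¬ IsInt3 t := by
      rintro a b t h ⟨n, d, hd, hn⟩
      refine hint ⟨d, hd, fun i => ⟨d * (a i).val + n * (((a i).val : ℤ) - (b i).val), ?_⟩⟩
      rw [h i]; push_cast; rw [← hn]; simp only [gridPt]; ring
    obtain ⟨a, b, hab, t, ht, h⟩ := hex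
    refine ⟨a, fun c d hcd s hs h' => ?_⟩
    have nt := nonint a b t h
    have ns := nonint c d s h'
    have ht0 : t ≠ 0 := by rintro rfl; exact nt (by simpa using isInt3_nat 0)
    have hs0 : s ≠ 0 := by rintro rfl; exact ns (by simpa using isInt3_nat 0)
    have ht1 : t ≠ 1 := by rintro rfl; exact nt (by simpa using isInt3_nat 1)
    have hs1 : s ≠ 1 := by rintro rfl; exact ns (by simpa using isInt3_nat 1)
    have htp : 0 < t := lt_of_le_of_ne ht (Ne.symm ht0)
    have hsp : 0 < s := lt_of_le_of_ne hs (Ne.symm hs0)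
    have off : ∀ i, a i = b i ∨ c i = d i → a i = c i ∧ c i = d i := by
      intro i hi
      have h1 := h i
      have h2 := h' i
      simp only [gridPt] at h1 h2
      have hi1 : a i = b i := by
        rcases hi with hi | hi
        · exact hi
        · by_contra hne
          refine nt (isInt3_of_coord _ _ hne t (P i) ?_ h1)
          rw [h2, hi, sub_self, mul_zero, add_zero]; exact isInt3_nat _
      have hi2 : c i = d i := by
        by_contra hne
        refine ns (isInt3_of_coord _ _ hne s (P i) ?_ h2)
        rw [h1, hi1, sub_self, mul_zero, add_zero]; exact isInt3_nat _
      refine ⟨?_, hi2⟩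
      rw [← hi1] at h1
      rw [← hi2] at h2
      simp only [sub_self, mul_zero, add_zero] at h1 h2
      have : (a i).val = (c i).val := by exact_mod_cast h1.symm.trans h2
      exact ZMod.val_injective 3 this
    have on : ∀ i, ¬ (a i = b i ∨ c i = d i) → _ := fun i hi =>
      coord_cases (a i) (b i) (c i) (d i) (fun q => hi (Or.inl q)) (fun q => hi (Or.inr q)) t s
        htp hsp ((h i).symm.trans (h' i))
    by_cases c1 : s = t ∨ t = 2 * s ∨ s = 2 * t
    · refine ⟨0, fun i => ?_⟩
      by_cases hi : a i = b i ∨ c i = d i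
      · obtain ⟨q1, q2⟩ := off i hi
        rw [q1, q2]; ring
      · rcases on i hi with q | q | q
        · exact q.2
        · exfalso
          rcases c1 with c1 | c1 | c1
          · linarith [q.1]
          · exact hs1 (by linarith [q.1])
          · linarith [q.1]
        · exfalso
          rcases c1 with c1 | c1 | c1 <;> rcases q.1 with q | q | q <;>
            first
            | linarith
            | exact hs1 (by linarith)
            | exact ht1 (by linarith)
    by_cases c2 : t = 1 + s
    · refine ⟨2, fun i => ?_⟩
      by_cases hi : a i = b i ∨ c i = d i
      · obtain ⟨q1, q2⟩ := off i hi
        rw [q1, q2]; ring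
      · rcases on i hi with q | q | q
        · exact absurd q.1 c1
        · exact q.2
        · exfalso
          rcases q.1 with q | q | q <;> linarith
    · refine ⟨1, fun i => ?_⟩
      by_cases hi : a i = b i ∨ c i = d i
      · obtain ⟨q1, q2⟩ := off i hi
        rw [q1, q2]; ring
      · rcases on i hi with q | q | q
        · exact absurd q.1 c1
        · exact absurd q.1 c2
        · exact q.2

lemma gridPt_injective {k : ℕ} : Function.Injective (gridPt (k := k)) := by
  intro a b h
  funext i
  have := congrFun h i
  simp only [gridPt] at this
  exact ZMod.val_injective 3 (by exact_mod_cast this)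

lemma exists_gridPt {k : ℕ} (x : Fin k → ℝ) (hx : ∀ i, x i ∈ ({0, 1, 2} : Set ℝ)) :
    ∃ a, gridPt a = x := by
  have : ∀ i, ∃ z : ZMod 3, (z.val : ℝ) = x i := by
    intro i
    rcases hx i with h | h | h
    · exact ⟨0, by rw [h]; norm_num⟩
    · exact ⟨1, by rw [h, show (1 : ZMod 3).val = 1 from rfl]; norm_num⟩
    · exact ⟨2, by rw [h, show (2 : ZMod 3).val = 2 from rfl]; norm_num⟩
  choose a ha using this
  exact ⟨a, funext ha⟩

lemma gridPt_mem {k : ℕ} (a : Fin k → ZMod 3) (i : Fin k) :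
    gridPt a i ∈ ({0, 1, 2} : Set ℝ) := by
  have e : ∀ x : ZMod 3, x.val = 0 ∨ x.val = 1 ∨ x.val = 2 := by decide
  simp only [gridPt]
  rcases e (a i) with h | h | h <;> rw [h] <;> simp

/-- Two distinct points of a segment can be ordered. -/
lemma order_on_segment {k : ℕ} (p q x y : Fin k → ℝ) (hx : x ∈ segment ℝ p q)
    (hy : y ∈ segment ℝ p q) (hxy : x ≠ y) :
    (∃ t s : ℝ, 0 ≤ t ∧ 0 ≤ s ∧ (∀ i, p i = x i + t * (x i - y i)) ∧
      (∀ i, q i = y i + s * (y i - x i))) ∨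
    (∃ t s : ℝ, 0 ≤ t ∧ 0 ≤ s ∧ (∀ i, p i = y i + t * (y i - x i)) ∧
      (∀ i, q i = x i + s * (x i - y i))) := by
  rw [segment_eq_image'] at hx hy
  obtain ⟨α, ⟨hα0, hα1⟩, rfl⟩ := hx
  obtain ⟨β, ⟨hβ0, hβ1⟩, rfl⟩ := hy
  rcases lt_trichotomy α β with hlt | heq | hlt
  · left
    have hp : 0 < β - α := by linarith
    refine ⟨α / (β - α), (1 - β) / (β - α), by positivity,
      div_nonneg (by linarith) hp.le, fun i => ?_, fun i => ?_⟩ <;>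
    · simp only [Pi.add_apply, Pi.smul_apply, Pi.sub_apply, smul_eq_mul]
      field_simp
      ring
  · exact absurd (by rw [heq]) hxy
  · right
    have hp : 0 < α - β := by linarith
    refine ⟨β / (α - β), (1 - α) / (α - β), by positivity,
      div_nonneg (by linarith) hp.le, fun i => ?_, fun i => ?_⟩ <;>
    · simp only [Pi.add_apply, Pi.smul_apply, Pi.sub_apply, smul_eq_mul]
      field_simp
      ring

lemma collinear_on_segment {k : ℕ} (p q x y z : Fin k → ℝ) (hx : x ∈ segment ℝ p q)
    (hy : y ∈ segment ℝ p q) (hz : z ∈ segment ℝ p q) (hxy : x ≠ y) :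
    ∃ t : ℝ, ∀ i, z i = x i + t * (x i - y i) := by
  rw [segment_eq_image'] at hx hy hz
  obtain ⟨α, -, rfl⟩ := hx
  obtain ⟨β, -, rfl⟩ := hy
  obtain ⟨γ, -, rfl⟩ := hz
  have hne : α - β ≠ 0 := by
    intro h
    exact hxy (by rw [sub_eq_zero.mp h])
  refine ⟨(γ - α) / (α - β), fun i => ?_⟩
  simp only [Pi.add_apply, Pi.smul_apply, Pi.sub_apply, smul_eq_mul]
  field_simp
  ring

/-- Each segment is contained in a 3-element set containing the reductions of its endpoints. -/
lemma segment_set {k : ℕ} (r : (Fin k → ℝ) → (Fin k → ZMod 3))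
    (hr : ∀ P, ∀ a b : Fin k → ZMod 3, a ≠ b → ∀ t : ℝ, 0 ≤ t →
      (∀ i, P i = gridPt a i + t * (gridPt a i - gridPt b i)) →
      ∃ μ : ZMod 3, ∀ i, r P i = a i + μ * (a i - b i))
    (p q : Fin k → ℝ) : ∃ F : Finset (Fin k → ZMod 3), F.card ≤ 3 ∧ r p ∈ F ∧ r q ∈ F ∧
      ∀ a, gridPt a ∈ segment ℝ p q → a ∈ F := by
  classical
  have line : ∀ (a b : Fin k → ZMod 3), ∀ t s : ℝ, a ≠ b → 0 ≤ t → 0 ≤ s →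
      (∀ i, p i = gridPt a i + t * (gridPt a i - gridPt b i)) →
      (∀ i, q i = gridPt b i + s * (gridPt b i - gridPt a i)) →
      (∃ μ : ZMod 3, ∀ i, r p i = a i + μ * (a i - b i)) ∧
      (∃ μ : ZMod 3, ∀ i, r q i = b i + μ * (b i - a i)) := fun a b t s hab ht hs h1 h2 =>
    ⟨hr p a b hab t ht h1, hr q b a hab.symm s hs h2⟩
  have e : ∀ x : ZMod 3, x = 0 ∨ x = 1 ∨ x = 2 := by decide
  have f1 : ∀ x y : ZMod 3, x + 2 * (x - y) = y := by decide
  have f2 : ∀ x y : ZMod 3, x + 1 * (x - y) = -(x + y) := by decide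
  have conv : ∀ (c a b : Fin k → ZMod 3), (∃ μ : ZMod 3, ∀ i, c i = a i + μ * (a i - b i)) →
      c = a ∨ c = b ∨ c = -(a + b) := by
    rintro c a b ⟨μ, hμ⟩
    rcases e μ with rfl | rfl | rfl
    · left; funext i; rw [hμ i]; ring
    · right; right; funext i; rw [hμ i, f2]; rfl
    · right; left; funext i; rw [hμ i, f1]
  have pair : ∀ a b : Fin k → ZMod 3, a ≠ b → gridPt a ∈ segment ℝ p q →
      gridPt b ∈ segment ℝ p q →
      (r p = a ∨ r p = b ∨ r p = -(a + b)) ∧ (r q = a ∨ r q = b ∨ r q = -(a + b)) := by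
    intro a b hab ha hb
    rcases order_on_segment p q _ _ ha hb (fun h => hab (gridPt_injective h)) with
      ⟨t, s, ht, hs, h1, h2⟩ | ⟨t, s, ht, hs, h1, h2⟩
    · obtain ⟨u, v⟩ := line a b t s hab ht hs h1 h2
      have u' := conv _ _ _ u
      have v' := conv _ _ _ v
      rw [add_comm b a] at v'
      tauto
    · obtain ⟨u, v⟩ := line b a t s hab.symm ht hs h1 h2
      have u' := conv _ _ _ u
      have v' := conv _ _ _ v
      rw [add_comm b a] at u'
      tauto
  by_cases h2 : ∃ a b : Fin k → ZMod 3, a ≠ b ∧ gridPt a ∈ segment ℝ p q ∧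
      gridPt b ∈ segment ℝ p q
  · obtain ⟨a, b, hab, ha, hb⟩ := h2
    obtain ⟨hp, hq⟩ := pair a b hab ha hb
    refine ⟨{a, b, -(a + b)}, Finset.card_le_three, by simpa using hp, by simpa using hq, ?_⟩
    intro c hc
    obtain ⟨t, ht⟩ := collinear_on_segment p q _ _ _ ha hb hc
      (fun h => hab (gridPt_injective h))
    have hc' := red_int (gridPt c) 1 (by simp) (fun i => ((c i).val : ℤ))
      (fun i => by simp only [gridPt]; push_cast; ring) a b hab t ht
    simp only [val_cast_int] at hc'
    simpa using conv c a b hc'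
  · by_cases h1 : ∃ a : Fin k → ZMod 3, gridPt a ∈ segment ℝ p q
    · obtain ⟨a, ha⟩ := h1
      refine ⟨{a, r p, r q}, Finset.card_le_three, by simp, by simp, fun c hc => ?_⟩
      have : c = a := by
        by_contra hne
        exact h2 ⟨c, a, hne, hc, ha⟩
      simp [this]
    · exact ⟨{r p, r p, r q}, Finset.card_le_three, by simp, by simp,
        fun c hc => absurd ⟨c, hc⟩ h1⟩

theorem chain_covers_at_most (k m : ℕ) (p : Fin (m + 1) → (Fin k → ℝ)) :
    ({x : Fin k → ℝ | (∀ i, x i ∈ ({0, 1, 2} : Set ℝ)) ∧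
        ∃ j : Fin m, x ∈ segment ℝ (p j.castSucc) (p j.succ)}).ncard ≤ 2 * m + 1 ∧
    ((∀ x : Fin k → ℝ, (∀ i, x i ∈ ({0, 1, 2} : Set ℝ)) →
        ∃ j : Fin m, x ∈ segment ℝ (p j.castSucc) (p j.succ)) →
      (3 ^ k - 1) / 2 ≤ m) := by
  classical
  choose r hr using exists_red (k := k)
  choose F hF3 hFp hFq hF using segment_set r hr
  have ind : ∀ n : ℕ, (hn : n ≤ m) → ∃ W : Finset (Fin k → ZMod 3), W.card ≤ 2 * n + 1 ∧
      r (p ⟨n, by omega⟩) ∈ W ∧ ∀ j : Fin m, j.val < n → F (p j.castSucc) (p j.succ) ⊆ W := by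
    intro n
    induction n with
    | zero => exact fun _ => ⟨{r (p ⟨0, by omega⟩)}, by simp, by simp, by simp⟩
    | succ n ih =>
      intro hn
      obtain ⟨W, hW, hrW, hsub⟩ := ih (by omega)
      let j : Fin m := ⟨n, by omega⟩
      refine ⟨W ∪ F (p j.castSucc) (p j.succ), ?_, ?_, ?_⟩
      · have h1 := Finset.card_union_add_card_inter W (F (p j.castSucc) (p j.succ))
        have h2 : 0 < (W ∩ F (p j.castSucc) (p j.succ)).card :=
          Finset.card_pos.mpr ⟨r (p j.castSucc), Finset.mem_inter.mpr ⟨hrW, hFp _ _⟩⟩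
        have h3 := hF3 (p j.castSucc) (p j.succ)
        omega
      · exact Finset.mem_union_right _ (hFq (p j.castSucc) (p j.succ))
      · intro i hi
        rcases Nat.lt_succ_iff_lt_or_eq.mp hi with h | h
        · exact (hsub i h).trans Finset.subset_union_left
        · have : i = j := Fin.ext h
          rw [this]
          exact Finset.subset_union_right
  obtain ⟨W, hW, -, hsub⟩ := ind m le_rfl
  have main : ({x : Fin k → ℝ | (∀ i, x i ∈ ({0, 1, 2} : Set ℝ)) ∧
        ∃ j : Fin m, x ∈ segment ℝ (p j.castSucc) (p j.succ)}).ncard ≤ 2 * m + 1 := by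
    refine le_trans (Set.ncard_le_ncard (t := ((W.image gridPt : Finset _) : Set _)) ?_
      (Finset.finite_toSet _)) ?_
    · rintro x ⟨hx, j, hj⟩
      obtain ⟨a, rfl⟩ := exists_gridPt x hx
      simp only [Finset.coe_image]
      exact ⟨a, hsub j j.2 (hF _ _ a hj), rfl⟩
    · rw [Set.ncard_coe_finset]
      exact Finset.card_image_le.trans hW
  refine ⟨main, fun hcov => ?_⟩
  have huniv : W = Finset.univ := by
    ext a
    simp only [Finset.mem_univ, iff_true]
    obtain ⟨j, hj⟩ := hcov (gridPt a) (gridPt_mem a)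
    exact hsub j j.2 (hF _ _ a hj)
  have hcard : W.card = 3 ^ k := by
    rw [huniv, Finset.card_univ, Fintype.card_pi]
    simp
  omega
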